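/- Let x, x̂ ∈ ℝⁿ, let p ∈ ℝᵐ be nonzero, and let α > 0. Let A = (1/(α‖p‖₂²)) x pᵀ and = (1/(α‖p‖₂²)) x̂ pᵀ be the PLD matrices of x and x̂, and let H be any n×m real matrix with H p = 0. Set à = A + H. Then ‖ − Ã‖_F² = ‖x̂ − x‖₂² / ‖α p‖₂² + ‖H‖_F². -/

import Mathlib

open scoped BigOperators

/-- The PLD (Power Level Decomposition) matrix `A = (1/(α‖p‖₂²)) x pᵀ` of a load curve `x`. -/
noncomputable def PLD {n m : ℕ} (x : EuclideanSpace ℝ (Fin n)) (p : EuclideanSpace ℝ (Fin m))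
    (α : ℝ) : Matrix (Fin n) (Fin m) ℝ :=
  (1 / (α * ‖p‖ ^ 2)) • Matrix.vecMulVec (x : Fin n → ℝ) (p : Fin m → ℝ)

/-- The Frobenius norm of a real matrix. -/
noncomputable def frobNorm {n m : ℕ} (A : Matrix (Fin n) (Fin m) ℝ) : ℝ :=
  Real.sqrt (∑ i, ∑ j, (A i j) ^ 2)

theorem frobNorm_sq {n m : ℕ} (A : Matrix (Fin n) (Fin m) ℝ) :
    frobNorm A ^ 2 = ∑ i, ∑ j, A i j ^ 2 :=
  Real.sq_sqrt (by positivity)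

theorem PLD_sub {n m : ℕ} (x y : EuclideanSpace ℝ (Fin n)) (p : EuclideanSpace ℝ (Fin m))
    (α : ℝ) : PLD (x - y) p α = PLD x p α - PLD y p α := by
  ext i j
  simp [PLD, Matrix.vecMulVec_apply]
  ring

theorem frobNorm_PLD_sq {n m : ℕ} (x : EuclideanSpace ℝ (Fin n))
    {p : EuclideanSpace ℝ (Fin m)} (hp : p ≠ 0) (α : ℝ) :
    frobNorm (PLD x p α) ^ 2 = ‖x‖ ^ 2 / ‖α • p‖ ^ 2 := by
  have hp' : ‖p‖ ≠ 0 := norm_ne_zero_iff.mpr hp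
  have h : frobNorm (PLD x p α) ^ 2 = (1 / (α * ‖p‖ ^ 2)) ^ 2 * (‖x‖ ^ 2 * ‖p‖ ^ 2) := by
    rw [frobNorm_sq, EuclideanSpace.real_norm_sq_eq x]
    nth_rewrite 2 [EuclideanSpace.real_norm_sq_eq p]
    rw [Finset.sum_mul_sum, Finset.mul_sum]
    refine Finset.sum_congr rfl fun i _ => ?_
    rw [Finset.mul_sum]
    refine Finset.sum_congr rfl fun j _ => ?_
    simp only [PLD, Matrix.smul_apply, Matrix.vecMulVec_apply, smul_eq_mul]
    ring
  rw [h, norm_smul, mul_pow, Real.norm_eq_abs, sq_abs]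
  rcases eq_or_ne α 0 with rfl | hα
  · simp
  · field_simp

theorem sum_PLD_mul_eq_zero {n m : ℕ} (x : EuclideanSpace ℝ (Fin n))
    (p : EuclideanSpace ℝ (Fin m)) (α : ℝ) {H : Matrix (Fin n) (Fin m) ℝ}
    (hH : H.mulVec (p : Fin m → ℝ) = 0) :
    ∑ i, ∑ j, PLD x p α i j * H i j = 0 := by
  refine Finset.sum_eq_zero fun i _ => ?_
  have h : ∑ j, H i j * p j = 0 := congrFun hH i
  calc ∑ j, PLD x p α i j * H i j
      = 1 / (α * ‖p‖ ^ 2) * x i * ∑ j, H i j * p j := by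
        rw [Finset.mul_sum]
        refine Finset.sum_congr rfl fun j _ => ?_
        simp only [PLD, Matrix.smul_apply, Matrix.vecMulVec_apply, smul_eq_mul]
        ring
    _ = 0 := by rw [h, mul_zero]

theorem frobNorm_sub_sq {n m : ℕ} (A B : Matrix (Fin n) (Fin m) ℝ) :
    frobNorm (A - B) ^ 2
      = frobNorm A ^ 2 - 2 * ∑ i, ∑ j, A i j * B i j + frobNorm B ^ 2 := by
  simp only [frobNorm_sq, Matrix.sub_apply, sub_sq, Finset.sum_add_distrib,
    Finset.sum_sub_distrib, Finset.mul_sum, mul_assoc]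

/-- with `Ã = A + H` and `H p = 0`,
`‖Â − Ã‖_F² = ‖x̂ − x‖₂² / ‖α p‖₂² + ‖H‖_F²`. -/
theorem stmt_4 {n m : ℕ} (x xhat : EuclideanSpace ℝ (Fin n)) (p : EuclideanSpace ℝ (Fin m))
    (hp : p ≠ 0) (α : ℝ) (hα : 0 < α)
    (H : Matrix (Fin n) (Fin m) ℝ) (hH : H.mulVec (p : Fin m → ℝ) = 0) :
    frobNorm (PLD xhat p α - (PLD x p α + H)) ^ 2
      = ‖xhat - x‖ ^ 2 / ‖α • p‖ ^ 2 + frobNorm H ^ 2 := by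
  rw [← sub_sub, ← PLD_sub, frobNorm_sub_sq, sum_PLD_mul_eq_zero _ _ _ hH, frobNorm_PLD_sq _ hp,
    mul_zero, sub_zero]
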